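/- Let m be an odd integer with m ≥ 3, let G be a finite simple graph with maximum degree Δ(G) ≥ 2, and let n be an integer with m < n. If φ is a proper vertex coloring of G^{m/n} using exactly ω(G^{m/n}) colors, then for every vertex u of G of degree Δ(G), all vertices of the crust C_u receive the same color under φ. -/

import Mathlib

open SimpleGraph

/-- Representations of vertices of the `n`-subdivision of `G`: `(u, u, 0)` represents the
branch vertex `u`, and for an adjacent pair `(u, v)`, the triple `(u, v, i)` with `i ≤ n`
represents the point at distance `i` from `u` on the path of length `n` replacing the
edge `uv`. -/
def SubdivPre {V : Type*} (G : SimpleGraph V) (n : ℕ) : Type _ :=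
  {p : V × V × ℕ // (p.1 = p.2.1 ∧ p.2.2 = 0) ∨ (G.Adj p.1 p.2.1 ∧ p.2.2 ≤ n)}

/-- The identifications between representations: `(u, v, i)` and `(v, u, n - i)` represent
the same point, and `(u, v, 0)` represents the branch vertex `u`, i.e. `(u, u, 0)`. -/
inductive SubdivRel {V : Type*} (G : SimpleGraph V) (n : ℕ) :
    SubdivPre G n → SubdivPre G n → Prop
  | flip (u v : V) (i : ℕ) (h : G.Adj u v) (hi : i ≤ n) :
      SubdivRel G n ⟨(u, v, i), Or.inr ⟨h, hi⟩⟩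
        ⟨(v, u, n - i), Or.inr ⟨h.symm, Nat.sub_le n i⟩⟩
  | collapse (u v : V) (h : G.Adj u v) :
      SubdivRel G n ⟨(u, v, 0), Or.inr ⟨h, Nat.zero_le n⟩⟩ ⟨(u, u, 0), Or.inl ⟨rfl, rfl⟩⟩

/-- The vertex set of the `n`-subdivision of `G`. -/
def SubdivVert {V : Type*} (G : SimpleGraph V) (n : ℕ) : Type _ := Quot (SubdivRel G n)

/-- The branch vertex of the subdivision corresponding to a vertex `u` of `G`. -/
def branchVertex {V : Type*} (G : SimpleGraph V) (n : ℕ) (u : V) : SubdivVert G n :=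
  Quot.mk _ ⟨(u, u, 0), Or.inl ⟨rfl, rfl⟩⟩

/-- The vertex `(uv)_i` of the subdivision: the point at distance `i` from `u` on the
path of length `n` replacing the edge `uv`. -/
def mkVert {V : Type*} (G : SimpleGraph V) (n : ℕ) {u v : V} (h : G.Adj u v)
    (i : ℕ) (hi : i ≤ n) : SubdivVert G n :=
  Quot.mk _ ⟨(u, v, i), Or.inr ⟨h, hi⟩⟩

/-- The `n`-subdivision `G^{1/n}` of `G`: each edge of `G` is replaced by a path of
length `n`; consecutive points on such a path are adjacent. -/
def subdivision {V : Type*} (G : SimpleGraph V) (n : ℕ) : SimpleGraph (SubdivVert G n) :=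
  SimpleGraph.fromRel (fun x y => ∃ (u v : V) (h : G.Adj u v) (i : ℕ) (hi : i < n),
    x = mkVert G n h i (le_of_lt hi) ∧ y = mkVert G n h (i + 1) hi)

/-- The `m`-power of a graph: two distinct vertices are adjacent iff their distance is
at most `m`, i.e. iff there is a walk of length at most `m` between them. -/
def powerGraph {W : Type*} (H : SimpleGraph W) (m : ℕ) : SimpleGraph W :=
  SimpleGraph.fromRel (fun x y => ∃ w : H.Walk x y, w.length ≤ m)

/-- The fractional power `G^{m/n}`, the `m`-power of the `n`-subdivision of `G`. -/
def fracPower {V : Type*} (G : SimpleGraph V) (m n : ℕ) : SimpleGraph (SubdivVert G n) :=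
  powerGraph (subdivision G n) m

open Classical in
/-- Distance to the branch vertex `u`, capped at `n`. -/
noncomputable def capDist {V : Type*} (n : ℕ) (u x y : V) (i : ℕ) : ℕ :=
  if x = u then i else if y = u then n - i else n

open Classical in
/-- A 1-Lipschitz lower bound for the distance to `(uv)_a`. -/
noncomputable def lipPre {V : Type*} (n : ℕ) (u v : V) (a : ℕ) (x y : V) (i : ℕ) : ℕ :=
  if x = u ∧ y = v then (i - a) + (a - i)
  else if x = v ∧ y = u then ((n - i) - a) + (a - (n - i))
  else min (a + capDist n u x y i) (n - a + capDist n v x y i)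

noncomputable def lip {V : Type*} (G : SimpleGraph V) (n : ℕ) {u v : V} (h : G.Adj u v) (a : ℕ)
    (ha : a ≤ n) : SubdivVert G n → ℕ :=
  Quot.lift (fun p => lipPre n u v a p.1.1 p.1.2.1 p.1.2.2) (by
    have huv := h.ne
    rintro _ _ (⟨x, y, i, hxy, hi⟩ | ⟨x, y, hxy⟩)
    · have := hxy.ne
      simp only [lipPre, capDist]
      grind
    · have := hxy.ne
      simp only [lipPre, capDist]
      grind)

theorem lip_mk {V : Type*} (G : SimpleGraph V) (n : ℕ) {u v : V} (h : G.Adj u v) (a : ℕ)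
    (ha : a ≤ n) {x y : V} (hxy : G.Adj x y) (i : ℕ) (hi : i ≤ n) :
    lip G n h a ha (mkVert G n hxy i hi) = lipPre n u v a x y i := rfl

theorem lip_step {V : Type*} (G : SimpleGraph V) (n : ℕ) {u v : V} (h : G.Adj u v) (a : ℕ)
    (ha : a ≤ n) {p q : SubdivVert G n} (hpq : (subdivision G n).Adj p q) :
    lip G n h a ha p ≤ lip G n h a ha q + 1 := by
  have huv := h.ne
  rw [subdivision, SimpleGraph.fromRel_adj] at hpq
  obtain ⟨-, ⟨x, y, hxy, i, hi, rfl, rfl⟩ | ⟨x, y, hxy, i, hi, rfl, rfl⟩⟩ := hpq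
  · have := hxy.ne
    simp only [lip_mk, lipPre, capDist]
    grind
  · have := hxy.ne
    simp only [lip_mk, lipPre, capDist]
    grind

theorem lip_walk {V : Type*} (G : SimpleGraph V) (n : ℕ) {u v : V} (h : G.Adj u v) (a : ℕ)
    (ha : a ≤ n) {p q : SubdivVert G n} (w : (subdivision G n).Walk p q) :
    lip G n h a ha p ≤ lip G n h a ha q + w.length := by
  induction w with
  | nil => simp
  | cons hpq w ih =>
    have := lip_step G n h a ha hpq
    simp only [SimpleGraph.Walk.length_cons]
    omega

theorem lip_self {V : Type*} (G : SimpleGraph V) (n : ℕ) {u v : V} (h : G.Adj u v) (a : ℕ)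
    (ha : a ≤ n) : lip G n h a ha (mkVert G n h a ha) = 0 := by
  simp [lip_mk, lipPre]

/-- Elements of a clique are within `lip`-distance `m`. -/
theorem lip_clique {V : Type*} (G : SimpleGraph V) (m n : ℕ) (K : Finset (SubdivVert G n))
    (hK : (fracPower G m n).IsClique K) {u v : V} (h : G.Adj u v) (a : ℕ) (ha : a ≤ n)
    (hp : mkVert G n h a ha ∈ K) {q : SubdivVert G n} (hq : q ∈ K) :
    lip G n h a ha q ≤ m := by
  by_cases e : q = mkVert G n h a ha
  · rw [e, lip_self]; omega
  · have := hK hq hp e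
    rw [fracPower, powerGraph, SimpleGraph.fromRel_adj] at this
    have h0 := lip_self G n h a ha
    obtain ⟨-, ⟨w, hw⟩ | ⟨w, hw⟩⟩ := this
    · have := lip_walk G n h a ha w
      omega
    · have := lip_walk G n h a ha w.reverse
      rw [SimpleGraph.Walk.length_reverse] at this
      omega

theorem lip_clique_mk {V : Type*} (G : SimpleGraph V) (m n : ℕ) (K : Finset (SubdivVert G n))
    (hK : (fracPower G m n).IsClique K) {u v : V} (h : G.Adj u v) (a : ℕ) (ha : a ≤ n)
    (hp : mkVert G n h a ha ∈ K) {x y : V} (hxy : G.Adj x y) (i : ℕ) (hi : i ≤ n)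
    (hq : mkVert G n hxy i hi ∈ K) :
    lipPre n u v a x y i ≤ m := by
  rw [← lip_mk G n h a ha hxy i hi]
  exact lip_clique G m n K hK h a ha hp hq

theorem mkVert_flip {V : Type*} (G : SimpleGraph V) (n : ℕ) {u v : V} (h : G.Adj u v)
    (i : ℕ) (hi : i ≤ n) : mkVert G n h i hi = mkVert G n h.symm (n - i) (Nat.sub_le n i) :=
  Quot.sound (SubdivRel.flip u v i h hi)

theorem mkVert_zero {V : Type*} (G : SimpleGraph V) (n : ℕ) {u v : V} (h : G.Adj u v) :
    mkVert G n h 0 (Nat.zero_le n) = branchVertex G n u :=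
  Quot.sound (SubdivRel.collapse u v h)

theorem exists_mk_of_walk {V : Type*} (G : SimpleGraph V) (n : ℕ) {p q : SubdivVert G n}
    (w : (subdivision G n).Walk p q) (hne : p ≠ q) :
    ∃ (u v : V) (h : G.Adj u v) (i : ℕ) (hi : i ≤ n), p = mkVert G n h i hi := by
  cases w with
  | nil => exact absurd rfl hne
  | cons hpq w =>
    rw [subdivision, SimpleGraph.fromRel_adj] at hpq
    obtain ⟨-, ⟨x, y, hxy, i, hi, rfl, rfl⟩ | ⟨x, y, hxy, i, hi, rfl, rfl⟩⟩ := hpq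
    · exact ⟨_, _, hxy, _, _, rfl⟩
    · exact ⟨_, _, hxy, _, _, rfl⟩

theorem exists_mk_of_adj {V : Type*} (G : SimpleGraph V) (m n : ℕ) {p q : SubdivVert G n}
    (hpq : (fracPower G m n).Adj p q) :
    ∃ (u v : V) (h : G.Adj u v) (i : ℕ) (hi : i ≤ n), p = mkVert G n h i hi := by
  rw [fracPower, powerGraph, SimpleGraph.fromRel_adj] at hpq
  obtain ⟨hne, ⟨w, hw⟩ | ⟨w, hw⟩⟩ := hpq
  · exact exists_mk_of_walk G n w hne
  · exact exists_mk_of_walk G n w.reverse hne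

def InStar {V : Type*} (G : SimpleGraph V) (n : ℕ) (u : V) (q : SubdivVert G n) : Prop :=
  ∃ (v : V) (h : G.Adj u v) (i : ℕ) (hi : i ≤ n), q = mkVert G n h i hi

/-- Clique points share an endpoint with a given clique edge. -/
theorem share {V : Type*} (G : SimpleGraph V) (m n : ℕ) (hmn : m < n)
    (K : Finset (SubdivVert G n))
    (hK : (fracPower G m n).IsClique K) {u v : V} (h : G.Adj u v) (a : ℕ) (ha : a ≤ n)
    (hp : mkVert G n h a ha ∈ K) {x y : V} (hxy : G.Adj x y) (i : ℕ) (hi : i ≤ n)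
    (hq : mkVert G n hxy i hi ∈ K) : x = u ∨ x = v ∨ y = u ∨ y = v := by
  have := lip_clique_mk G m n K hK h a ha hp hxy i hi hq
  simp only [lipPre, capDist] at this
  grind

theorem star_bound {V : Type*} (G : SimpleGraph V) (m n : ℕ) (hmn : m < n)
    (K : Finset (SubdivVert G n))
    (hK : (fracPower G m n).IsClique K) {u v x : V} (h : G.Adj u v) (a : ℕ) (ha : a ≤ n)
    (hp : mkVert G n h a ha ∈ K) (hux : G.Adj u x) (i : ℕ) (hi : i ≤ n)
    (hq : mkVert G n hux i hi ∈ K) (hne : x ≠ v) : a + i ≤ m := by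
  have := lip_clique_mk G m n K hK h a ha hp hux i hi hq
  have h1 := h.ne
  have h2 := hux.ne
  simp only [lipPre, capDist] at this
  grind

theorem edge_bound {V : Type*} (G : SimpleGraph V) (m n : ℕ)
    (K : Finset (SubdivVert G n))
    (hK : (fracPower G m n).IsClique K) {u v : V} (h : G.Adj u v) (a : ℕ) (ha : a ≤ n)
    (hp : mkVert G n h a ha ∈ K) (i : ℕ) (hi : i ≤ n)
    (hq : mkVert G n h i hi ∈ K) : a ≤ i + m := by
  have := lip_clique_mk G m n K hK h a ha hp h i hi hq
  simp only [lipPre] at this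
  grind

theorem exists_star {V : Type*} (G : SimpleGraph V) (m n : ℕ) (hmn : m < n)
    (K : Finset (SubdivVert G n)) (hK : (fracPower G m n).IsClique K) (h1 : 1 < K.card) :
    ∃ u, ∀ q ∈ K, InStar G n u q := by
  have hmk : ∀ p ∈ K, ∃ (u v : V) (h : G.Adj u v) (i : ℕ) (hi : i ≤ n),
      p = mkVert G n h i hi := by
    intro p hp
    obtain ⟨q, hq, hne⟩ := Finset.exists_mem_ne h1 p
    exact exists_mk_of_adj G m n (hK hp hq hne.symm)
  obtain ⟨p, hp⟩ : K.Nonempty := Finset.card_pos.mp (by omega)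
  obtain ⟨u, v, h, a, ha, rfl⟩ := hmk p hp
  have huv : ∀ q ∈ K, InStar G n u q ∨ InStar G n v q := by
    intro q hq
    obtain ⟨x, y, hxy, i, hi, rfl⟩ := hmk q hq
    rcases share G m n hmn K hK h a ha hp hxy i hi hq with rfl | rfl | rfl | rfl
    · exact Or.inl ⟨y, hxy, i, hi, rfl⟩
    · exact Or.inr ⟨y, hxy, i, hi, rfl⟩
    · exact Or.inl ⟨x, hxy.symm, _, _, mkVert_flip G n hxy i hi⟩
    · exact Or.inr ⟨x, hxy.symm, _, _, mkVert_flip G n hxy i hi⟩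
  by_contra hcon
  push Not at hcon
  obtain ⟨q1, hq1, hs1⟩ := hcon u
  obtain ⟨q2, hq2, hs2⟩ := hcon v
  obtain ⟨x, hx, b, hb, rfl⟩ := (huv q1 hq1).resolve_left hs1
  obtain ⟨y, hy, c, hc, rfl⟩ := (huv q2 hq2).resolve_right hs2
  have hxu : x ≠ u := by
    rintro rfl
    exact hs1 ⟨v, hx.symm, _, _, mkVert_flip G n hx b hb⟩
  have hyv : y ≠ v := by
    rintro rfl
    exact hs2 ⟨u, hy.symm, _, _, mkVert_flip G n hy c hc⟩
  have hxy : x = y := by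
    have := share G m n hmn K hK hx b hb hq1 hy c hc hq2
    have := h.ne
    grind
  subst hxy
  have e1 := star_bound G m n hmn K hK h a ha hp hy c hc hq2 hyv
  have hp' := hp
  rw [mkVert_flip] at hp'
  have e2 := star_bound G m n hmn K hK h.symm _ _ hp' hx b hb hq1 hxu
  rw [mkVert_flip] at hq1 hq2
  have e3 := star_bound G m n hmn K hK hx.symm _ _ hq1 hy.symm _ _ hq2 h.ne
  omega

open Classical in
noncomputable def pt {V : Type*} (G : SimpleGraph V) (n : ℕ) (u : V) (t : V × ℕ) :
    SubdivVert G n :=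
  if h : G.Adj u t.1 ∧ t.2 ≤ n then mkVert G n h.1 t.2 h.2 else branchVertex G n u

theorem pt_eq {V : Type*} (G : SimpleGraph V) (n : ℕ) {u v : V} (h : G.Adj u v) (i : ℕ)
    (hi : i ≤ n) : pt G n u (v, i) = mkVert G n h i hi := by
  simp [pt, h, hi]

theorem clique_card {V : Type*} [Fintype V] (G : SimpleGraph V)
    [DecidableRel G.Adj] (hΔ : 2 ≤ G.maxDegree)
    (k n : ℕ) (hmn : 2 * k + 1 < n)
    (K : Finset (SubdivVert G n)) (hK : (fracPower G (2 * k + 1) n).IsClique K) :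
    K.card ≤ k * G.maxDegree + 2 := by
  classical
  by_cases h1 : 1 < K.card
  swap
  · omega
  obtain ⟨u, hu⟩ := exists_star G _ n hmn K hK h1
  haveI : Nonempty V := ⟨u⟩
  choose! nb hnb co hco heq using hu
  obtain ⟨q0, hq0, hmax⟩ := Finset.exists_max_image K co (Finset.card_pos.mp (by omega))
  set a0 := co q0 with ha0
  set v0 := nb q0 with hv0
  have hdeg : G.degree u ≤ G.maxDegree := G.degree_le_maxDegree u
  have hmem0 : mkVert G n (hnb q0 hq0) a0 (hco q0 hq0) ∈ K := by
    rw [← heq q0 hq0]; exact hq0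
  have key : ∀ q (hq : q ∈ K), nb q ≠ v0 → a0 + co q ≤ 2 * k + 1 := by
    intro q hq hne
    have : mkVert G n (hnb q hq) (co q) (hco q hq) ∈ K := by
      rw [← heq q hq]; exact hq
    exact star_bound G _ n hmn K hK (hnb q0 hq0) a0 _ hmem0 (hnb q hq) (co q) _ this hne
  by_cases hc : 2 * k + 1 < a0
  · have hsub : K ⊆ (Finset.Icc (a0 - (2 * k + 1)) a0).image (fun i => pt G n u (v0, i)) := by
      intro q hq
      have hv : nb q = v0 := by
        by_contra hne
        have := key q hq hne
        omega
      have hqe : q = mkVert G n (hnb q0 hq0) (co q) (hco q hq) := by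
        rw [← pt_eq]
        conv_lhs => rw [heq q hq, ← pt_eq, hv]
      have hqm : mkVert G n (hnb q0 hq0) (co q) (hco q hq) ∈ K := by
        rw [← hqe]; exact hq
      have := edge_bound G _ n K hK (hnb q0 hq0) a0 _ hmem0 (co q) _ hqm
      refine Finset.mem_image.mpr ⟨co q, Finset.mem_Icc.mpr ⟨by omega, hmax q hq⟩, ?_⟩
      rw [pt_eq G n (hnb q0 hq0) (co q) (hco q hq), ← hqe]
    have h2 := (Finset.card_le_card hsub).trans Finset.card_image_le
    rw [Nat.card_Icc] at h2
    nlinarith [Nat.mul_le_mul_left k hΔ, (by omega : a0 + 1 - (a0 - (2 * k + 1)) = 2 * k + 2)]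
  · set c := min a0 (2 * k + 1 - a0) with hcdef
    have hsub : K ⊆ (({v0} ×ˢ Finset.range (a0 + 1)) ∪
        ((G.neighborFinset u).erase v0 ×ˢ Finset.Icc 1 c)).image (pt G n u) := by
      intro q hq
      rw [Finset.mem_image]
      by_cases hv : nb q = v0
      · refine ⟨(v0, co q), ?_, ?_⟩
        · have := hmax q hq
          simp; omega
        · rw [← hv, pt_eq G n (hnb q hq) (co q) (hco q hq)]
          exact (heq q hq).symm
      · by_cases hz : co q = 0
        · refine ⟨(v0, 0), by simp, ?_⟩
          rw [pt_eq G n (hnb q0 hq0) 0 (Nat.zero_le _), mkVert_zero, ← mkVert_zero G n (hnb q hq),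
            ← pt_eq, ← hz]
          conv_rhs => rw [heq q hq, ← pt_eq]
        · refine ⟨(nb q, co q), ?_, ?_⟩
          · have h3 := hmax q hq
            have h4 := key q hq hv
            have h5 := hnb q hq
            simp [hv, h5]
            omega
          · rw [pt_eq G n (hnb q hq) (co q) (hco q hq)]
            exact (heq q hq).symm
    have h2 := ((Finset.card_le_card hsub).trans Finset.card_image_le).trans
      (Finset.card_union_le _ _)
    have hv0m : v0 ∈ G.neighborFinset u := by simpa using hnb q0 hq0
    rw [Finset.card_product, Finset.card_product, Finset.card_erase_of_mem hv0m] at h2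
    simp only [Finset.card_singleton, Finset.card_range, Nat.card_Icc,
      SimpleGraph.card_neighborFinset_eq_degree] at h2
    obtain ⟨D, hD⟩ : ∃ D, G.maxDegree = D + 2 := ⟨G.maxDegree - 2, by omega⟩
    rw [hD] at hdeg ⊢
    have h3 : (G.degree u - 1) * (c + 1 - 1) ≤ (D + 1) * c :=
      Nat.mul_le_mul (by omega) (by omega)
    have h4 : D * c ≤ D * k := Nat.mul_le_mul_left _ (by omega)
    have h5 : a0 + c ≤ 2 * k + 1 := by omega
    nlinarith

theorem walk_from_branch {V : Type*} (G : SimpleGraph V) (n : ℕ) {u v : V} (h : G.Adj u v)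
    (i : ℕ) (hi : i ≤ n) :
    ∃ w : (subdivision G n).Walk (branchVertex G n u) (mkVert G n h i hi), w.length ≤ i := by
  induction i with
  | zero => rw [mkVert_zero]; exact ⟨.nil, by simp⟩
  | succ i ih =>
    obtain ⟨w, hw⟩ := ih (by omega)
    by_cases e : mkVert G n h i (by omega) = mkVert G n h (i + 1) hi
    · rw [← e]; exact ⟨w, by omega⟩
    · have hadj : (subdivision G n).Adj (mkVert G n h i (by omega)) (mkVert G n h (i + 1) hi) := by
        rw [subdivision, SimpleGraph.fromRel_adj]
        exact ⟨e, Or.inl ⟨u, v, h, i, hi, rfl, rfl⟩⟩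
      exact ⟨w.concat hadj, by rw [SimpleGraph.Walk.length_concat]; omega⟩

theorem adj_star {V : Type*} (G : SimpleGraph V) (m n : ℕ) (hmn : m < n) {u v x : V}
    (h : G.Adj u v) (i : ℕ) (hi : i ≤ n) (hx : G.Adj u x) (j : ℕ) (hj : j ≤ n)
    (hij : i + j ≤ m) (hne : i ≠ j ∨ (v ≠ x ∧ 0 < i)) :
    (fracPower G m n).Adj (mkVert G n h i hi) (mkVert G n hx j hj) := by
  rw [fracPower, powerGraph, SimpleGraph.fromRel_adj]
  refine ⟨?_, Or.inl ?_⟩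
  · intro e
    have h0 := lip_self G n h i hi
    rw [e, lip_mk] at h0
    have h1 := h.ne
    have h2 := hx.ne
    simp only [lipPre, capDist] at h0
    grind
  · obtain ⟨w, hw⟩ := walk_from_branch G n h i hi
    obtain ⟨w', hw'⟩ := walk_from_branch G n hx j hj
    exact ⟨w.reverse.append w', by
      rw [SimpleGraph.Walk.length_append, SimpleGraph.Walk.length_reverse]; omega⟩

theorem crust_monochromatic {V : Type*} [Fintype V] (G : SimpleGraph V)
    [DecidableRel G.Adj] (hΔ : 2 ≤ G.maxDegree)
    (m n : ℕ) (hm : Odd m) (hm3 : 3 ≤ m) (hmn : m < n)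
    (φ : SubdivVert G n → Fin (fracPower G m n).cliqueNum)
    (hproper : ∀ x y, (fracPower G m n).Adj x y → φ x ≠ φ y)
    (hsurj : Function.Surjective φ) :
    ∀ u : V, G.degree u = G.maxDegree →
      ∀ (v w : V) (hv : G.Adj u v) (hw : G.Adj u w),
        φ (mkVert G n hv ((m + 1) / 2) (by omega)) =
          φ (mkVert G n hw ((m + 1) / 2) (by omega)) := by
  classical
  intro u hu v w hv hw
  obtain ⟨k, rfl⟩ := hm
  have hω : (fracPower G (2 * k + 1) n).cliqueNum ≤ k * G.maxDegree + 2 := by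
    refine csSup_le ⟨0, ∅, by simp [SimpleGraph.isNClique_iff]⟩ ?_
    rintro _ ⟨K, hK⟩
    rw [← hK.card_eq]
    exact clique_card G hΔ k n hmn K hK.isClique
  let T : Finset (V × ℕ) := insert (v, 0) (G.neighborFinset u ×ˢ Finset.Icc 1 k)
  have hT : T.card = k * G.maxDegree + 1 := by
    rw [Finset.card_insert_of_notMem (by simp), Finset.card_product]
    simp [hu, mul_comm]
  have hTmem : ∀ t ∈ T, G.Adj u t.1 ∧ t.2 ≤ k ∧ (t.2 = 0 → t.1 = v) := by
    rintro ⟨x, i⟩ ht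
    simp only [T, Finset.mem_insert, Prod.mk.injEq, Finset.mem_product,
      SimpleGraph.mem_neighborFinset, Finset.mem_Icc] at ht
    rcases ht with ⟨rfl, rfl⟩ | ⟨h1, h2⟩
    · exact ⟨hv, by simp, by simp⟩
    · exact ⟨h1, h2.2, fun h => by simp at h; omega⟩
  have hinj : Set.InjOn (fun t => φ (pt G n u t)) T := by
    rintro ⟨x, i⟩ hx ⟨y, j⟩ hy hxy
    obtain ⟨h1, h2, h3⟩ := hTmem _ hx
    obtain ⟨h4, h5, h6⟩ := hTmem _ hy
    dsimp only at *
    by_contra hne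
    rw [pt_eq G n h1 i (by omega), pt_eq G n h4 j (by omega)] at hxy
    refine hproper _ _ (adj_star G _ n hmn h1 i (by omega) h4 j (by omega) (by omega) ?_) hxy
    by_cases hij : i = j
    · right
      subst hij
      have : x ≠ y := fun e => hne (by rw [e])
      refine ⟨this, Nat.pos_of_ne_zero fun e => this ?_⟩
      rw [h3 e, h6 e]
    · exact Or.inl hij
  have hS : (T.image (fun t => φ (pt G n u t))).card = k * G.maxDegree + 1 := by
    rw [Finset.card_image_of_injOn hinj, hT]
  have hout : ∀ (x : V) (hx : G.Adj u x), φ (mkVert G n hx ((2 * k + 1 + 1) / 2) (by omega)) ∈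
      (T.image (fun t => φ (pt G n u t)))ᶜ := by
    intro x hx
    rw [Finset.mem_compl, Finset.mem_image]
    rintro ⟨⟨y, j⟩, hy, he⟩
    obtain ⟨h4, h5, h6⟩ := hTmem _ hy
    dsimp only at *
    rw [pt_eq G n h4 j (by omega)] at he
    exact hproper _ _ (adj_star G _ n hmn h4 j (by omega) hx _ (by omega) (by omega)
      (Or.inl (by omega))) he
  have hcard : (T.image (fun t => φ (pt G n u t)))ᶜ.card ≤ 1 := by
    rw [Finset.card_compl, hS, Fintype.card_fin]
    omega
  exact Finset.card_le_one.mp hcard _ (hout v hv) _ (hout w hw)
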